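/- Let S be a quasi completely regular semiring and let ρ be the least completely regular semiring congruence on S. Then for all a, b ∈ S, a ρ b if and only if a+0_a = b+0_b. -/

import Mathlib

/-- A "semiring" in the sense of the paper: both reducts are semigroups
(no commutativity, no identities) and multiplication distributes over
addition on both sides. -/
class PSemiring (S : Type*) extends AddSemigroup S, Semigroup S where
  left_distrib : ∀ a b c : S, a * (b + c) = a * b + a * c
  right_distrib : ∀ a b c : S, (a + b) * c = a * c + b * c

namespace PSemiring

variable {S : Type*} [PSemiring S]

/-- `nmul n a` is the `(n+1)`-fold sum `a + ⋯ + a`; thus the positive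
multiple `m·a` of the paper is `nmul (m-1) a`. -/
def nmul : ℕ → S → S
  | 0, a => a
  | n + 1, a => nmul n a + a

/-- `a` is additively regular. -/
def AddRegular (a : S) : Prop := ∃ x, a + x + a = a

/-- `a` is a completely regular element. -/
def CompletelyRegularElem (a : S) : Prop :=
  ∃ x, a = a + x + a ∧ a + x = x + a ∧ a * (a + x) = a + x

/-- `S` is a quasi completely regular semiring. -/
def QuasiCompletelyRegular (S : Type*) [PSemiring S] : Prop :=
  ∀ a : S, ∃ n : ℕ, CompletelyRegularElem (nmul n a)

/-- `S` is a completely regular semiring. -/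
def CompletelyRegularSemiring (S : Type*) [PSemiring S] : Prop :=
  ∀ a : S, CompletelyRegularElem a

/-- `e` is an additive idempotent (i.e. `e ∈ E⁺(S)`). -/
def AddIdem (e : S) : Prop := e + e = e

/-- `V⁺(a)`, the set of additive inverses of `a`. -/
def Vplus (a : S) : Set S := {x | a + x + a = a ∧ x + a + x = x}

/-- `{a} ∪ (S + a)`. -/
def lset (a : S) : Set S := insert a {x | ∃ s, x = s + a}

/-- `{a} ∪ (a + S)`. -/
def rset (a : S) : Set S := insert a {x | ∃ s, x = a + s}

/-- `{a} ∪ (S + a) ∪ (a + S) ∪ (S + a + S)`. -/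
def jset (a : S) : Set S :=
  insert a ({x | ∃ s, x = s + a} ∪ {x | ∃ s, x = a + s} ∪ {x | ∃ s t, x = s + a + t})

/-- Green's relation `L⁺` on the additive reduct. -/
def GreenL (a b : S) : Prop := lset a = lset b

/-- Green's relation `R⁺` on the additive reduct. -/
def GreenR (a b : S) : Prop := rset a = rset b

/-- Green's relation `J⁺` on the additive reduct. -/
def GreenJ (a b : S) : Prop := jset a = jset b

/-- `n` is the least index such that the `(n+1)`-fold sum of `a` is additively
regular, i.e. `(n+1)·a` is the least additively regular positive multiple. -/
def LeastReg (a : S) (n : ℕ) : Prop :=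
  AddRegular (nmul n a) ∧ ∀ m < n, ¬ AddRegular (nmul m a)

/-- The relation `L*⁺`. -/
def LStar (a b : S) : Prop :=
  ∃ p q, LeastReg a p ∧ LeastReg b q ∧ GreenL (nmul p a) (nmul q b)

/-- The relation `R*⁺`. -/
def RStar (a b : S) : Prop :=
  ∃ p q, LeastReg a p ∧ LeastReg b q ∧ GreenR (nmul p a) (nmul q b)

/-- The relation `J*⁺`. -/
def JStar (a b : S) : Prop :=
  ∃ p q, LeastReg a p ∧ LeastReg b q ∧ GreenJ (nmul p a) (nmul q b)

/-- `H*⁺ = L*⁺ ∩ R*⁺`. -/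
def HStar (a b : S) : Prop := LStar a b ∧ RStar a b

/-- `D*⁺ = L*⁺ ∘ R*⁺` (relational composition). -/
def DStar (a b : S) : Prop := ∃ c, LStar a c ∧ RStar c b

/-- `z = 0_a`: `z = na + x` where `n` is the least positive integer with `na`
completely regular and `x` is the (unique) element with `na = na+x+na`,
`x = x+na+x` and `na+x = x+na`. -/
def IsZeroOf (a z : S) : Prop :=
  ∃ n x, (CompletelyRegularElem (nmul n a) ∧
      ∀ m < n, ¬ CompletelyRegularElem (nmul m a)) ∧
    nmul n a = nmul n a + x + nmul n a ∧ x = x + nmul n a + x ∧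
    nmul n a + x = x + nmul n a ∧ z = nmul n a + x

/-- The relation `𝒴`, relative to a choice `z` of the map `a ↦ 0_a`. -/
def Yrel (z : S → S) (a b : S) : Prop := Vplus (a + z a) = Vplus (b + z b)

/-- A (semiring) congruence. -/
structure IsCong (r : S → S → Prop) : Prop where
  refl : ∀ a, r a a
  symm : ∀ {a b}, r a b → r b a
  trans : ∀ {a b c}, r a b → r b c → r a c
  addl : ∀ (c : S) {a b}, r a b → r (c + a) (c + b)
  addr : ∀ (c : S) {a b}, r a b → r (a + c) (b + c)
  mull : ∀ (c : S) {a b}, r a b → r (c * a) (c * b)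
  mulr : ∀ (c : S) {a b}, r a b → r (a * c) (b * c)

/-- `r` is a b-lattice congruence: `S/r` is a b-lattice. -/
def IsBLatticeCong (r : S → S → Prop) : Prop :=
  IsCong r ∧ (∀ a : S, r (a * a) a) ∧ (∀ a : S, r (a + a) a) ∧
    ∀ a b : S, r (a + b) (b + a)

/-- `r` is the least b-lattice congruence. -/
def IsLeastBLatticeCong (r : S → S → Prop) : Prop :=
  IsBLatticeCong r ∧ ∀ r', IsBLatticeCong r' → ∀ a b, r a b → r' a b

/-- `r` is a skew-ring congruence: `S/r` is a semiring whose additive reduct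
is a group (expressed by solvability of both translation equations). -/
def IsSkewRingCong (r : S → S → Prop) : Prop :=
  IsCong r ∧ ∀ a b : S, (∃ x, r (a + x) b) ∧ ∃ y, r (y + a) b

/-- `r` is the least skew-ring congruence. -/
def IsLeastSkewRingCong (r : S → S → Prop) : Prop :=
  IsSkewRingCong r ∧ ∀ r', IsSkewRingCong r' → ∀ a b, r a b → r' a b

/-- `η` is a b-lattice-of-skew-rings congruence: `S/η` admits a congruence `ξ`
(given here as a congruence on `S` containing `η`) such that `(S/η)/ξ` is a
b-lattice and every `ξ`-class of `S/η` is a subsemiring whose additive reduct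
is a group. -/
def IsBLSRCong (η : S → S → Prop) : Prop :=
  IsCong η ∧ ∃ ξ : S → S → Prop, IsCong ξ ∧ (∀ a b, η a b → ξ a b) ∧
    (∀ a : S, ξ (a * a) a) ∧ (∀ a : S, ξ (a + a) a) ∧
    (∀ a b : S, ξ (a + b) (b + a)) ∧
    (∀ a b, ξ a b → ξ (a + b) a ∧ ξ (a * b) a) ∧
    ∀ a b, ξ a b → (∃ x, ξ x a ∧ η (a + x) b) ∧ ∃ y, ξ y a ∧ η (y + a) b

/-- `ν` is the least b-lattice-of-skew-rings congruence. -/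
def IsLeastBLSRCong (ν : S → S → Prop) : Prop :=
  IsBLSRCong ν ∧ ∀ η, IsBLSRCong η → ∀ a b, ν a b → η a b

/-- `r` is a completely regular semiring congruence: `S/r` is completely
regular. -/
def IsCRCong (r : S → S → Prop) : Prop :=
  IsCong r ∧ ∀ a : S, ∃ x, r a (a + x + a) ∧ r (a + x) (x + a) ∧
    r (a * (a + x)) (a + x)

/-- `ρ` is the least completely regular semiring congruence. -/
def IsLeastCRCong (r : S → S → Prop) : Prop :=
  IsCRCong r ∧ ∀ r', IsCRCong r' → ∀ a b, r a b → r' a b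

/-- `S` is quasi-orthodox. -/
def QuasiOrthodox (S : Type*) [PSemiring S] : Prop :=
  ∀ e f : S, AddIdem e → AddIdem f →
    ∃ n : ℕ, nmul n (e + f) = nmul (n + 1) (e + f)

/-- `S` is a completely Archimedean semiring. -/
def CompletelyArchimedean (S : Type*) [PSemiring S] : Prop :=
  QuasiCompletelyRegular S ∧ ∀ a b : S, JStar a b

/-- `r` is the least congruence containing the relation `τ`. -/
def IsLeastCongContaining (τ r : S → S → Prop) : Prop :=
  IsCong r ∧ (∀ a b, τ a b → r a b) ∧
    ∀ r', IsCong r' → (∀ a b, τ a b → r' a b) → ∀ a b, r a b → r' a b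

/-- `r` is a generalized additive idempotent pure congruence (purity part). -/
def GenAddIdemPure (r : S → S → Prop) : Prop :=
  ∀ a e : S, AddIdem e → r a e → ∃ n : ℕ, nmul n a = nmul (n + 1) a

/-- `τ^e`: `a = x + c + y`, `b = x + d + y` for some `(c,d) ∈ τ`, where each of
`x`, `y` may also be absent (i.e. `x, y ∈ S⁰`). -/
def relE (τ : S → S → Prop) (a b : S) : Prop :=
  ∃ c d, τ c d ∧ ((a = c ∧ b = d) ∨ (∃ x, a = x + c ∧ b = x + d) ∨
    (∃ y, a = c + y ∧ b = d + y) ∨ ∃ x y, a = x + c + y ∧ b = x + d + y)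

/-- `τ^♮`: the transitive closure of `(τ ∪ τ⁻¹ ∪ ε)^e`. -/
def natClosure (τ : S → S → Prop) : S → S → Prop :=
  Relation.TransGen (relE (fun a b => τ a b ∨ τ b a ∨ a = b))

end PSemiring

open PSemiring

namespace PSemiring

variable {S : Type*} [PSemiring S]

theorem AddIdem.mul_left {e : S} (he : AddIdem e) (a : S) : AddIdem (a * e) := by
  unfold AddIdem at *
  rw [← PSemiring.left_distrib, he]

theorem AddIdem.mul_right {e : S} (he : AddIdem e) (a : S) : AddIdem (e * a) := by
  unfold AddIdem at *
  rw [← PSemiring.right_distrib, he]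

theorem AddIdem.add_add_cancel {e : S} (he : AddIdem e) (s : S) : s + e + e = s + e := by
  rw [add_assoc, he]

theorem add_nmul (n : ℕ) (a : S) : a + nmul n a = nmul n a + a := by
  induction n with
  | zero => rfl
  | succ n ih => rw [nmul, ← add_assoc, ih]

theorem nmul_mul_idem {e : S} (he : AddIdem e) (n : ℕ) (a : S) : nmul n a * e = a * e := by
  induction n with
  | zero => rfl
  | succ n ih => rw [nmul, PSemiring.right_distrib, ih, he.mul_left a]

theorem idem_mul_nmul {e : S} (he : AddIdem e) (n : ℕ) (a : S) : e * nmul n a = e * a := by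
  induction n with
  | zero => rfl
  | succ n ih => rw [nmul, PSemiring.left_distrib, ih, he.mul_right a]

theorem AddIdem.eq_of_add_eq {p q r : S} (hp : AddIdem p) (h₁ : p + q = r) (h₂ : q + p = r)
    (h₃ : r + p = p) : p = r :=
  calc p = r + p := h₃.symm
    _ = p + (q + p) := by rw [← h₁, add_assoc]
    _ = p + p + q := by rw [h₂, ← h₁, add_assoc]
    _ = r := by rw [hp, h₁]

theorem IsZeroOf.addIdem {a z : S} (h : IsZeroOf a z) : AddIdem z := by
  obtain ⟨n, x, -, h₁, -, -, rfl⟩ := h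
  rw [AddIdem, ← add_assoc, ← h₁]

theorem IsZeroOf.mul_idem {a z : S} (h : IsZeroOf a z) {e : S} (he : AddIdem e) :
    a * e = z * e := by
  obtain ⟨n, x, -, h₁, -, h₃, rfl⟩ := h
  rw [← nmul_mul_idem he n a]
  refine (he.mul_left _).eq_of_add_eq (q := x * e) ?_ ?_ ?_
  · rw [← PSemiring.right_distrib]
  · rw [← PSemiring.right_distrib, h₃]
  · rw [← PSemiring.right_distrib, ← h₁]

theorem IsZeroOf.idem_mul {a z : S} (h : IsZeroOf a z) {e : S} (he : AddIdem e) :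
    e * a = e * z := by
  obtain ⟨n, x, -, h₁, -, h₃, rfl⟩ := h
  rw [← idem_mul_nmul he n a]
  refine (he.mul_right _).eq_of_add_eq (q := e * x) ?_ ?_ ?_
  · rw [← PSemiring.left_distrib]
  · rw [← PSemiring.left_distrib, h₃]
  · rw [← PSemiring.left_distrib, ← h₁]

theorem IsZeroOf.mul_self {a z : S} (h : IsZeroOf a z) : z * z = z := by
  have hmul := h.mul_idem h.addIdem
  rw [← hmul]
  obtain ⟨n, x, ⟨⟨y, hy₁, hy₂, hy₃⟩, -⟩, h₁, -, h₃, hz⟩ := id h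
  have hyz : nmul n a + y = z :=
    calc nmul n a + y = z + (nmul n a + y) := by rw [hz, ← add_assoc, ← h₁]
      _ = x + (nmul n a + y + nmul n a) := by
        rw [hz, h₃, add_assoc x, add_assoc _ y, ← hy₂]
      _ = z := by rw [← hy₁, ← h₃, hz]
  rw [hyz, nmul_mul_idem h.addIdem] at hy₃
  exact hy₃

theorem IsZeroOf.add_comm {a z : S} (h : IsZeroOf a z) : a + z = z + a := by
  obtain ⟨n, x, -, h₁, -, h₃, rfl⟩ := h
  set b := nmul n a with hb
  have hab : a + b = b + a := add_nmul n a
  calc a + (b + x) = b + x + b + a + x := by rw [← add_assoc, hab, ← h₁]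
    _ = b + x + a + (b + x) := by rw [add_assoc (b + x) b a, ← hab]; simp only [add_assoc]
    _ = x + (b + a) + (b + x) := by rw [h₃]; simp only [add_assoc]
    _ = x + a + (b + x + b) := by
      rw [← hab, add_assoc b x b, ← h₃]; simp only [add_assoc]
    _ = b + x + a := by rw [← h₁, h₃, add_assoc, hab, add_assoc]

theorem IsZeroOf.exists_add_eq {a z : S} (h : IsZeroOf a z) : ∃ t, a + t = z ∧ t + a = z := by
  have hcomm := h.add_comm
  obtain ⟨n, x, -, h₁, h₂, h₃, rfl⟩ := h
  cases n with
  | zero => exact ⟨x, rfl, h₃.symm⟩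
  | succ k =>
    have hax : a + x = x + a := by
      set b := nmul (k + 1) a with hb
      have hab : a + b = b + a := add_nmul _ a
      calc a + x = a + (b + x) + x := by
            conv_lhs => rw [h₂]
            rw [← h₃]; simp only [add_assoc]
        _ = x + (b + a) + x := by rw [hcomm, h₃]; simp only [add_assoc]
        _ = x + (a + (b + x)) := by rw [← hab]; simp only [add_assoc]
        _ = x + a := by rw [hcomm, ← add_assoc, ← add_assoc, ← h₂]
    refine ⟨nmul k a + x, ?_, ?_⟩
    · rw [← add_assoc, add_nmul, nmul]
    · rw [add_assoc, ← hax, ← add_assoc, nmul]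

theorem IsZeroOf.eq_of_mul_eq {a b u v : S} (hu : IsZeroOf a u) (hv : IsZeroOf b v)
    (hl : ∀ e, AddIdem e → a * e = b * e) (hr : ∀ e, AddIdem e → e * a = e * b) : u = v :=
  calc u = v * u := by
        rw [← hv.mul_idem hu.addIdem, ← hl u hu.addIdem, hu.mul_idem hu.addIdem, hu.mul_self]
    _ = v := by
        rw [← hu.idem_mul hv.addIdem, hr v hv.addIdem, hv.idem_mul hv.addIdem, hv.mul_self]

variable {z : S → S}

theorem zero_congr (hz : ∀ a, IsZeroOf a (z a)) {a b : S}
    (hl : ∀ e, AddIdem e → a * e = b * e) (hr : ∀ e, AddIdem e → e * a = e * b) : z a = z b :=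
  (hz a).eq_of_mul_eq (hz b) hl hr

theorem AddIdem.zero_eq (hz : ∀ a, IsZeroOf a (z a)) {e : S} (he : AddIdem e) : z e = e := by
  obtain ⟨t, h₁, h₂⟩ := (hz e).exists_add_eq
  have h : e + z e = z e := by rw [← h₁, ← add_assoc, he]
  obtain ⟨n, x, -, h₃, -, -, h₄⟩ := hz e
  have hn : nmul n e = e := by
    clear h₃ h₄
    induction n with
    | zero => rfl
    | succ n ih => rw [nmul, ih, he]
  rw [hn] at h₃ h₄
  rw [← h, (hz e).add_comm, h₄, ← h₃]

/-- If adding `g` on the right of an idempotent `f` is invisible to multiplication by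
idempotents, then `g` is absorbed by `f`. -/
theorem AddIdem.add_right_absorb (hz : ∀ a, IsZeroOf a (z a)) {f g : S} (hf : AddIdem f)
    (hg : AddIdem g) (hl : ∀ e, AddIdem e → f * e + g * e = f * e)
    (hr : ∀ e, AddIdem e → e * f + e * g = e * f) : f + g = f := by
  have hzero : z (f + g) = f := by
    conv_rhs => rw [← hf.zero_eq hz]
    exact zero_congr hz (fun e he => by rw [PSemiring.right_distrib, hl e he])
      (fun e he => by rw [PSemiring.left_distrib, hr e he])
  have hcomm : f + g + f = f + g := by
    have := (hz (f + g)).add_comm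
    rwa [hzero, ← add_assoc f f g, hf] at this
  have hidem : AddIdem (f + g) := by
    rw [AddIdem, ← add_assoc, hcomm, hg.add_add_cancel]
  rw [← hidem.zero_eq hz, hzero]

theorem AddIdem.add_left_absorb (hz : ∀ a, IsZeroOf a (z a)) {f g : S} (hf : AddIdem f)
    (hg : AddIdem g) (hl : ∀ e, AddIdem e → g * e + f * e = f * e)
    (hr : ∀ e, AddIdem e → e * g + e * f = e * f) : g + f = f := by
  have hzero : z (g + f) = f := by
    conv_rhs => rw [← hf.zero_eq hz]
    exact zero_congr hz (fun e he => by rw [PSemiring.right_distrib, hl e he])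
      (fun e he => by rw [PSemiring.left_distrib, hr e he])
  have hcomm : f + (g + f) = g + f := by
    have := (hz (g + f)).add_comm
    rw [hzero, hf.add_add_cancel] at this
    exact this.symm
  have hidem : AddIdem (g + f) := by
    rw [AddIdem, add_assoc, hcomm, ← add_assoc, hg]
  rw [← hidem.zero_eq hz, hzero]

theorem add_zero_mul_idem (hz : ∀ a, IsZeroOf a (z a)) (a : S) {e : S} (he : AddIdem e) :
    (a + z a) * e = a * e := by
  rw [PSemiring.right_distrib, ← (hz a).mul_idem he, he.mul_left a]

theorem idem_mul_add_zero (hz : ∀ a, IsZeroOf a (z a)) (a : S) {e : S} (he : AddIdem e) :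
    e * (a + z a) = e * a := by
  rw [PSemiring.left_distrib, ← (hz a).idem_mul he, he.mul_right a]

theorem zero_add_zero (hz : ∀ a, IsZeroOf a (z a)) (a : S) : z (a + z a) = z a :=
  zero_congr hz (fun _ he => add_zero_mul_idem hz a he) (fun _ he => idem_mul_add_zero hz a he)

/-- The relation `a + 0_a = b + 0_b`. -/
def ZeroTranslateRel (z : S → S) (a b : S) : Prop := a + z a = b + z b

theorem zeroTranslateRel_add_zero (hz : ∀ a, IsZeroOf a (z a)) (a : S) :
    ZeroTranslateRel z a (a + z a) := by
  rw [ZeroTranslateRel, zero_add_zero hz, (hz a).addIdem.add_add_cancel]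

theorem zeroTranslateRel_add_zero_add (hz : ∀ a, IsZeroOf a (z a)) (a c : S) :
    ZeroTranslateRel z (a + c) (a + z a + c) := by
  have hw : z (a + z a + c) = z (a + c) := zero_congr hz
    (fun e he => by
      rw [PSemiring.right_distrib, add_zero_mul_idem hz a he, PSemiring.right_distrib])
    (fun e he => by
      rw [PSemiring.left_distrib, idem_mul_add_zero hz a he, PSemiring.left_distrib])
  rw [ZeroTranslateRel, hw, (hz _).add_comm, ← hw, (hz (a + z a + c)).add_comm, hw]
  obtain ⟨t, ht, -⟩ := (hz (a + c)).exists_add_eq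
  have hwi := (hz (a + c)).addIdem
  set w := z (a + c)
  have hwr : w + a + (c + t) = w := by
    rw [← add_assoc, add_assoc w, add_assoc w, ht, hwi]
  have hreg : w + a + (c + t + (w + a)) = w + a := by
    rw [← add_assoc, hwr, ← add_assoc, hwi]
  have hf : AddIdem (c + t + (w + a)) := by
    rw [AddIdem, add_assoc (c + t), hreg]
  have habs : c + t + (w + a) + z a = c + t + (w + a) := by
    refine hf.add_right_absorb hz (hz a).addIdem (fun e he => ?_) (fun e he => ?_)
    · simp only [PSemiring.right_distrib]
      rw [← (hz a).mul_idem he, add_assoc, add_assoc (w * e), he.mul_left a]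
    · simp only [PSemiring.left_distrib]
      rw [← (hz a).idem_mul he, add_assoc, add_assoc (e * w), he.mul_right a]
  have hfix : w + a + z a = w + a := by
    rw [← hreg, add_assoc, habs]
  rw [← add_assoc, ← add_assoc, ← add_assoc, hfix]

theorem zeroTranslateRel_add_add_zero (hz : ∀ a, IsZeroOf a (z a)) (a c : S) :
    ZeroTranslateRel z (c + a) (c + (a + z a)) := by
  have hw : z (c + (a + z a)) = z (c + a) := zero_congr hz
    (fun e he => by
      rw [PSemiring.right_distrib, PSemiring.right_distrib c, add_zero_mul_idem hz a he])
    (fun e he => by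
      rw [PSemiring.left_distrib, PSemiring.left_distrib e c, idem_mul_add_zero hz a he])
  rw [ZeroTranslateRel, hw]
  obtain ⟨t, -, ht⟩ := (hz (c + a)).exists_add_eq
  have hwi := (hz (c + a)).addIdem
  set w := z (c + a)
  have hwr : t + c + (a + w) = w := by
    rw [← add_assoc, add_assoc t, ht, hwi]
  have hreg : a + w + (t + c) + (a + w) = a + w := by
    rw [add_assoc (a + w), hwr, hwi.add_add_cancel]
  have hf : AddIdem (a + w + (t + c)) := by
    rw [AddIdem, ← add_assoc (a + w + (t + c)), hreg]
  have habs : z a + (a + w + (t + c)) = a + w + (t + c) := by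
    refine hf.add_left_absorb hz (hz a).addIdem (fun e he => ?_) (fun e he => ?_)
    · simp only [PSemiring.right_distrib]
      rw [← (hz a).mul_idem he, ← add_assoc (a * e) (a * e + w * e), ← add_assoc (a * e) (a * e),
        he.mul_left a]
    · simp only [PSemiring.left_distrib]
      rw [← (hz a).idem_mul he, ← add_assoc (e * a) (e * a + e * w), ← add_assoc (e * a) (e * a),
        he.mul_right a]
  have hfix : z a + (a + w) = a + w := by
    rw [← hreg, ← add_assoc, habs]
  rw [(hz a).add_comm, add_assoc, add_assoc, add_assoc, hfix]

theorem zeroTranslateRel_mul_add_zero (hz : ∀ a, IsZeroOf a (z a)) (a c : S) :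
    ZeroTranslateRel z (c * a) (c * (a + z a)) := by
  have hw : z (c * (a + z a)) = z (c * a) := zero_congr hz
    (fun e he => by rw [mul_assoc, add_zero_mul_idem hz a he, mul_assoc])
    (fun e he => by rw [← mul_assoc, idem_mul_add_zero hz a (he.mul_right c), mul_assoc])
  have habs : z (c * a) + c * z a = z (c * a) := by
    refine (hz _).addIdem.add_right_absorb hz ((hz a).addIdem.mul_left c)
      (fun e he => ?_) (fun e he => ?_)
    · rw [← (hz _).mul_idem he, mul_assoc, mul_assoc, ← (hz a).mul_idem he]
      exact (he.mul_left a).mul_left c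
    · rw [← (hz _).idem_mul he, ← mul_assoc, ← mul_assoc, ← (hz a).idem_mul (he.mul_right c)]
      exact (he.mul_right c).mul_right a
  rw [ZeroTranslateRel, (hz (c * (a + z a))).add_comm, hw, PSemiring.left_distrib, ← add_assoc,
    ← (hz (c * a)).add_comm, add_assoc, habs]

theorem zeroTranslateRel_add_zero_mul (hz : ∀ a, IsZeroOf a (z a)) (a c : S) :
    ZeroTranslateRel z (a * c) ((a + z a) * c) := by
  have hw : z ((a + z a) * c) = z (a * c) := zero_congr hz
    (fun e he => by rw [mul_assoc, add_zero_mul_idem hz a (he.mul_left c), mul_assoc])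
    (fun e he => by rw [← mul_assoc, idem_mul_add_zero hz a he, mul_assoc])
  have habs : z (a * c) + z a * c = z (a * c) := by
    refine (hz _).addIdem.add_right_absorb hz ((hz a).addIdem.mul_right c)
      (fun e he => ?_) (fun e he => ?_)
    · rw [← (hz _).mul_idem he, mul_assoc, mul_assoc, ← (hz a).mul_idem (he.mul_left c)]
      exact (he.mul_left c).mul_left a
    · rw [← (hz _).idem_mul he, ← mul_assoc, ← mul_assoc, ← (hz a).idem_mul he]
      exact (he.mul_right a).mul_right c
  rw [ZeroTranslateRel, (hz ((a + z a) * c)).add_comm, hw, PSemiring.right_distrib, ← add_assoc,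
    ← (hz (a * c)).add_comm, add_assoc, habs]

theorem isCong_zeroTranslateRel (hz : ∀ a, IsZeroOf a (z a)) : IsCong (ZeroTranslateRel z) where
  refl _ := rfl
  symm h := Eq.symm h
  trans h₁ h₂ := Eq.trans h₁ h₂
  addl c a b h := by
    have h₁ := zeroTranslateRel_add_add_zero hz a c
    rw [show a + z a = b + z b from h] at h₁
    exact Eq.trans h₁ (zeroTranslateRel_add_add_zero hz b c).symm
  addr c a b h := by
    have h₁ := zeroTranslateRel_add_zero_add hz a c
    rw [show a + z a = b + z b from h] at h₁
    exact Eq.trans h₁ (zeroTranslateRel_add_zero_add hz b c).symm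
  mull c a b h := by
    have h₁ := zeroTranslateRel_mul_add_zero hz a c
    rw [show a + z a = b + z b from h] at h₁
    exact Eq.trans h₁ (zeroTranslateRel_mul_add_zero hz b c).symm
  mulr c a b h := by
    have h₁ := zeroTranslateRel_add_zero_mul hz a c
    rw [show a + z a = b + z b from h] at h₁
    exact Eq.trans h₁ (zeroTranslateRel_add_zero_mul hz b c).symm

theorem isCRCong_zeroTranslateRel (hz : ∀ a, IsZeroOf a (z a)) :
    IsCRCong (ZeroTranslateRel z) := by
  refine ⟨isCong_zeroTranslateRel hz, fun a => ?_⟩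
  obtain ⟨t, h₁, h₂⟩ := (hz a).exists_add_eq
  refine ⟨t, ?_, ?_, ?_⟩
  · rw [h₁, ← (hz a).add_comm]
    exact zeroTranslateRel_add_zero hz a
  · rw [h₁, h₂]
    rfl
  · rw [h₁, (hz a).mul_idem (hz a).addIdem, (hz a).mul_self]
    rfl

theorem IsCRCong.exists_rel_add_nmul {r : S → S → Prop} (hr : IsCRCong r) (a : S) (n : ℕ) :
    ∃ y, r a (y + nmul n a) := by
  obtain ⟨hc, hr⟩ := hr
  obtain ⟨x, h₁, h₂, -⟩ := hr a
  induction n with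
  | zero => exact ⟨a + x, h₁⟩
  | succ n ih =>
    obtain ⟨y, hy⟩ := ih
    refine ⟨x + y, hc.trans h₁ (hc.trans (hc.addr a h₂) ?_)⟩
    have := hc.addr a (hc.addl x hy)
    rwa [← add_assoc x y, add_assoc (x + y)] at this

theorem IsCRCong.rel_add_zero {r : S → S → Prop} (hr : IsCRCong r) {a w : S}
    (h : IsZeroOf a w) : r a (a + w) := by
  obtain ⟨n, x, -, h₁, -, h₃, rfl⟩ := h
  obtain ⟨y, hy⟩ := hr.exists_rel_add_nmul a n
  have := hr.1.addr (nmul n a + x) hy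
  rw [add_assoc y, h₃, ← add_assoc (nmul n a), ← h₁, ← h₃] at this
  exact hr.1.trans hy (hr.1.symm this)

end PSemiring

/-- In a quasi completely regular semiring `S`, the least
completely regular semiring congruence `ρ` satisfies:
`a ρ b` iff `a + 0_a = b + 0_b`. -/
theorem rho_iff_zero_translates {S : Type*} [PSemiring S]
    (hS : QuasiCompletelyRegular S) (z : S → S) (hz : ∀ a, IsZeroOf a (z a))
    (ρ : S → S → Prop) (hρ : IsLeastCRCong ρ) :
    ∀ a b : S, ρ a b ↔ a + z a = b + z b := by
  refine fun a b => ⟨hρ.2 _ (isCRCong_zeroTranslateRel hz) a b, fun h => ?_⟩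
  have ha := hρ.1.rel_add_zero (hz a)
  rw [h] at ha
  exact hρ.1.1.trans ha (hρ.1.1.symm (hρ.1.rel_add_zero (hz b)))
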